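/- Let D ≥ 1 and let q ∈ Q_∞ be a bounded increasing right-continuous path [0,1) → S^D_+ with left limits, with left-continuous version q⃗, and set T = tr q⃗(1) and assume T > 0. Then q admits a pinned decomposition (L, α) on [0,T] satisfying moreover tr L(t) = t for every t ∈ [0,T] and |L(t) − L(t')| ≤ √D · |t − t'| for all t, t' ∈ [0,T]. That is, there exist a p.d.f. α on [0,T] and a function L : [0,T] → S^D_+ that is increasing for the positive semidefinite order, Lipschitz with constant at most √D (in Frobenius norm), with L(0) = 0, tr L(t) = t for all t, and q⃗(s) = L(α⁻¹(s)) for every s ∈ (0,1]. -/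

import Mathlib

open Set Filter Topology Matrix

theorem aux_psd_limit {D : ℕ} {f : ℝ → Matrix (Fin D) (Fin D) ℝ} {A : Matrix (Fin D) (Fin D) ℝ}
    {l : Filter ℝ} [l.NeBot] (hf : Tendsto f l (𝓝 A)) (h : ∀ᶠ x in l, (f x).PosSemidef) :
    A.PosSemidef := by
  refine PosSemidef.of_dotProduct_mulVec_nonneg ?_ ?_
  · have h1 : Tendsto (fun x => (f x)ᴴ) l (𝓝 Aᴴ) :=
      (continuous_id.matrix_conjTranspose.tendsto A).comp hf
    have h2 : Tendsto (fun x => (f x)ᴴ) l (𝓝 A) :=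
      hf.congr' (by filter_upwards [h] with x hx using hx.1.eq.symm)
    exact tendsto_nhds_unique h1 h2
  · intro x
    have hc : Continuous (fun M : Matrix (Fin D) (Fin D) ℝ => star x ⬝ᵥ (M *ᵥ x)) := by
      fun_prop
    exact ge_of_tendsto ((hc.tendsto A).comp hf)
      (by filter_upwards [h] with y hy using hy.dotProduct_mulVec_nonneg x)

theorem aux_frob {D : ℕ} {A : Matrix (Fin D) (Fin D) ℝ} (hA : A.PosSemidef) :
    (A * Aᵀ).trace ≤ A.trace ^ 2 := by
  have h : ∀ i j, A i j * A i j ≤ A i i * A j j := by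
    intro i j
    have h1 := (hA.submatrix ![i, j]).det_nonneg
    have h2 : A j i = A i j := by simpa using hA.1.apply i j
    rw [det_fin_two] at h1
    simp [h2] at h1
    linarith
  have e1 : (A * Aᵀ).trace = ∑ i, ∑ j, A i j * A i j := by
    simp [Matrix.trace, Matrix.mul_apply]
  have e2 : A.trace ^ 2 = ∑ i, ∑ j, A i i * A j j := by
    rw [sq, Matrix.trace, Finset.sum_mul_sum]; rfl
  rw [e1, e2]
  exact Finset.sum_le_sum fun i _ => Finset.sum_le_sum fun j _ => h i j

theorem aux_trans {D : ℕ} {A B C : Matrix (Fin D) (Fin D) ℝ} (h1 : (B - A).PosSemidef)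
    (h2 : (C - B).PosSemidef) : (C - A).PosSemidef := by
  have := h2.add h1
  rwa [sub_add_sub_cancel] at this

theorem aux_tr {D : ℕ} {A B : Matrix (Fin D) (Fin D) ℝ} (h1 : (B - A).PosSemidef) :
    A.trace ≤ B.trace := by
  have := h1.trace_nonneg
  rw [trace_sub] at this
  linarith

/-- Let `D ≥ 1`, let `q ∈ Q_∞` (a bounded, increasing for the
PSD order, right-continuous path `[0,1) → S^D_+` with left limits), with
left-continuous version `qv` (so `qv 0 = 0` and `qv s = lim_{u↑s} q u` for
`s ∈ (0,1]`), and set `T = tr (qv 1)`, assumed positive.  Then `q` admits a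
pinned decomposition `(L, α)` on `[0,T]`: `α` is a p.d.f. on `[0,T]`,
`L : [0,T] → S^D_+` is increasing for the PSD order, Lipschitz with constant at
most `√D` in Frobenius norm, `L 0 = 0`, `tr (L t) = t` for all `t ∈ [0,T]`, and
`qv s = L (α⁻¹ s)` for every `s ∈ (0,1]`. -/
theorem exists_canonical_pinned_decomposition
    (D : ℕ) (hD : 1 ≤ D)
    (q qv : ℝ → Matrix (Fin D) (Fin D) ℝ)
    (hpsd : ∀ s ∈ Ico (0:ℝ) 1, (q s).PosSemidef)
    (hmono : ∀ ⦃u v : ℝ⦄, u ∈ Ico (0:ℝ) 1 → v ∈ Ico (0:ℝ) 1 → u ≤ v →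
      (q v - q u).PosSemidef)
    (hq_rc : ∀ s ∈ Ico (0:ℝ) 1, Tendsto q (𝓝[>] s) (𝓝 (q s)))
    (hbdd : ∃ C : ℝ, ∀ s ∈ Ico (0:ℝ) 1, Real.sqrt ((q s * (q s)ᵀ).trace) ≤ C)
    (hqv0 : qv 0 = 0)
    (hqv : ∀ s ∈ Ioc (0:ℝ) 1, Tendsto q (𝓝[<] s) (𝓝 (qv s)))
    (T : ℝ) (hTdef : T = (qv 1).trace) (hT : 0 < T) :
    ∃ (L : ℝ → Matrix (Fin D) (Fin D) ℝ) (α : ℝ → ℝ),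
      (∀ t ∈ Icc (0:ℝ) T, α t ∈ Icc (0:ℝ) 1) ∧
      (∀ ⦃t t' : ℝ⦄, t ∈ Icc 0 T → t' ∈ Icc 0 T → t ≤ t' → α t ≤ α t') ∧
      (∀ t ∈ Ico (0:ℝ) T, Tendsto α (𝓝[>] t) (𝓝 (α t))) ∧
      α T = 1 ∧
      (∀ t ∈ Icc (0:ℝ) T, (L t).PosSemidef) ∧
      (∀ ⦃t t' : ℝ⦄, t ∈ Icc 0 T → t' ∈ Icc 0 T → t ≤ t' →
        (L t' - L t).PosSemidef) ∧
      L 0 = 0 ∧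
      (∀ t ∈ Icc (0:ℝ) T, (L t).trace = t) ∧
      (∀ t ∈ Icc (0:ℝ) T, ∀ t' ∈ Icc (0:ℝ) T,
        Real.sqrt (((L t - L t') * (L t - L t')ᵀ).trace) ≤ Real.sqrt D * |t - t'|) ∧
      (∀ s ∈ Ioc (0:ℝ) 1, qv s = L (sInf {t : ℝ | t ∈ Icc 0 T ∧ s ≤ α t})) := by
  have htr : ∀ {l : Filter ℝ} {A : Matrix (Fin D) (Fin D) ℝ}, Tendsto q l (𝓝 A) →
      Tendsto (fun x => (q x).trace) l (𝓝 A.trace) := fun {l A} h =>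
    ((continuous_id.matrix_trace).tendsto A).comp h
  have F1 : ∀ u v : ℝ, 0 ≤ u → u < v → v ≤ 1 → (qv v - q u).PosSemidef := by
    intro u v hu huv hv
    refine aux_psd_limit ((hqv v ⟨by linarith, hv⟩).sub_const (q u)) ?_
    filter_upwards [Ioo_mem_nhdsLT huv] with w hw
    exact hmono ⟨hu, by linarith⟩ ⟨by linarith [hw.1], by linarith [hw.2]⟩ hw.1.le
  have F2 : ∀ s : ℝ, 0 ≤ s → s < 1 → (q s - qv s).PosSemidef := by
    intro s hs hs1
    rcases hs.eq_or_lt with rfl | h0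
    · rw [hqv0, sub_zero]; exact hpsd 0 ⟨le_rfl, hs1⟩
    · refine aux_psd_limit ((hqv s ⟨h0, hs1.le⟩).const_sub (q s)) ?_
      filter_upwards [Ioo_mem_nhdsLT h0] with w hw
      exact hmono ⟨hw.1.le, by linarith [hw.2]⟩ ⟨hs, hs1⟩ hw.2.le
  have F3 : ∀ s s' : ℝ, 0 ≤ s → s ≤ s' → s' ≤ 1 → (qv s' - qv s).PosSemidef := by
    intro s s' h0 h h1
    rcases h.eq_or_lt with rfl | h
    · rw [sub_self]; exact PosSemidef.zero
    · exact aux_trans (F2 s h0 (by linarith)) (F1 s s' h0 h h1)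
  have g0 : (qv 0).trace = 0 := by rw [hqv0]; simp
  have gT : ∀ s : ℝ, 0 ≤ s → s ≤ 1 → (qv s).trace ≤ T := fun s h0 h1 => by
    rw [hTdef]; exact aux_tr (F3 s 1 h0 h1 le_rfl)
  have gnn : ∀ s : ℝ, 0 ≤ s → s ≤ 1 → 0 ≤ (qv s).trace := fun s h0 h1 => by
    rw [← g0]; exact aux_tr (F3 0 s le_rfl h0 h1)
  -- the distribution function
  let S : ℝ → Set ℝ := fun t => {s | s ∈ Icc (0:ℝ) 1 ∧ (qv s).trace ≤ t}
  obtain ⟨α, hα⟩ : ∃ α : ℝ → ℝ, ∀ t, α t = sSup (S t) := ⟨fun t => sSup (S t), fun _ => rfl⟩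
  have Sbdd : ∀ t, BddAbove (S t) := fun t => ⟨1, fun s hs => hs.1.2⟩
  have S0 : ∀ t, 0 ≤ t → (0:ℝ) ∈ S t := fun t ht => ⟨⟨le_rfl, zero_le_one⟩, by rw [g0]; exact ht⟩
  have α0 : ∀ t, 0 ≤ t → 0 ≤ α t := fun t ht => by rw [hα]; exact le_csSup (Sbdd t) (S0 t ht)
  have α1 : ∀ t, 0 ≤ t → α t ≤ 1 := fun t ht => by
    rw [hα]; exact csSup_le ⟨0, S0 t ht⟩ (fun s hs => hs.1.2)
  have αatt : ∀ t, 0 ≤ t → (qv (α t)).trace ≤ t := by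
    intro t ht
    rcases (α0 t ht).eq_or_lt with h | h
    · rw [← h, g0]; exact ht
    · refine le_of_tendsto (htr (hqv (α t) ⟨h, α1 t ht⟩)) ?_
      filter_upwards [Ioo_mem_nhdsLT h] with u hu
      have hu2 := hu.2
      rw [hα] at hu2
      obtain ⟨s, hs, hus⟩ := exists_lt_of_lt_csSup ⟨0, S0 t ht⟩ hu2
      exact (aux_tr (F1 u s hu.1.le hus hs.1.2)).trans hs.2
  have gal : ∀ t, 0 ≤ t → ∀ s, 0 ≤ s → s ≤ 1 → (s ≤ α t ↔ (qv s).trace ≤ t) := by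
    intro t ht s h0 h1
    constructor
    · intro h
      exact (aux_tr (F3 s (α t) h0 h (α1 t ht))).trans (αatt t ht)
    · intro h
      rw [hα]; exact le_csSup (Sbdd t) ⟨⟨h0, h1⟩, h⟩
  have αmono : ∀ t t', 0 ≤ t → t ≤ t' → α t ≤ α t' := by
    intro t t' h0 h
    exact (gal t' (h0.trans h) _ (α0 t h0) (α1 t h0)).2 ((αatt t h0).trans h)
  have αT : α T = 1 :=
    le_antisymm (α1 T hT.le) ((gal T hT.le 1 zero_le_one le_rfl).2 hTdef.ge)
  -- the right-continuous version, extended to 1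
  let R : ℝ → Matrix (Fin D) (Fin D) ℝ := fun s => if s < 1 then q s else qv 1
  have Rlt : ∀ s, s < 1 → R s = q s := fun s h => if_pos h
  have R1 : R 1 = qv 1 := if_neg (lt_irrefl _)
  have RP : ∀ s : ℝ, 0 ≤ s → s ≤ 1 → (R s - qv s).PosSemidef := by
    intro s h0 h1
    rcases h1.eq_or_lt with rfl | h
    · rw [R1, sub_self]; exact PosSemidef.zero
    · rw [Rlt s h]; exact F2 s h0 h
  have αR : ∀ t, 0 ≤ t → t ≤ T → t ≤ (R (α t)).trace := by
    intro t h0 h1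
    rcases (α1 t h0).eq_or_lt with h | h
    · rw [h, R1, ← hTdef]; exact h1
    · rw [Rlt _ h]
      refine ge_of_tendsto (htr (hq_rc (α t) ⟨α0 t h0, h⟩)) ?_
      filter_upwards [Ioo_mem_nhdsGT h] with u hu
      have hu0 : 0 ≤ u := (α0 t h0).trans hu.1.le
      have h2 : t < (qv u).trace := by
        by_contra hc
        exact absurd ((gal t h0 u hu0 hu.2.le).2 (not_lt.1 hc)) (not_le.2 hu.1)
      exact h2.le.trans (aux_tr (F2 u hu0 hu.2))
  -- the Lipschitz path
  let c : ℝ → ℝ := fun t => (t - (qv (α t)).trace) / ((R (α t)).trace - (qv (α t)).trace)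
  obtain ⟨L, hL⟩ : ∃ L : ℝ → Matrix (Fin D) (Fin D) ℝ,
      ∀ t, L t = qv (α t) + c t • (R (α t) - qv (α t)) := ⟨_, fun _ => rfl⟩
  have c0 : ∀ t, 0 ≤ t → t ≤ T → 0 ≤ c t := fun t h0 h1 =>
    div_nonneg (by linarith [αatt t h0]) (by linarith [αatt t h0, αR t h0 h1])
  have c1 : ∀ t, 0 ≤ t → t ≤ T → c t ≤ 1 := fun t h0 h1 =>
    div_le_one_of_le₀ (by linarith [αR t h0 h1]) (by linarith [αatt t h0, αR t h0 h1])
  have Llow : ∀ t, 0 ≤ t → t ≤ T → (L t - qv (α t)).PosSemidef := by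
    intro t h0 h1
    rw [hL, add_sub_cancel_left]
    exact (RP _ (α0 t h0) (α1 t h0)).smul (c0 t h0 h1)
  have Lup : ∀ t, 0 ≤ t → t ≤ T → (R (α t) - L t).PosSemidef := by
    intro t h0 h1
    have : R (α t) - L t = (1 - c t) • (R (α t) - qv (α t)) := by
      rw [hL, sub_smul, one_smul]; abel
    rw [this]
    exact (RP _ (α0 t h0) (α1 t h0)).smul (by linarith [c1 t h0 h1])
  have Ltr : ∀ t, 0 ≤ t → t ≤ T → (L t).trace = t := by
    intro t h0 h1
    rw [hL, trace_add, trace_smul, trace_sub, smul_eq_mul]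
    have ha := αatt t h0
    have hb := αR t h0 h1
    rcases eq_or_ne ((R (α t)).trace - (qv (α t)).trace) 0 with h | h
    · rw [h]; linarith
    · simp only [c]; rw [div_mul_cancel₀ _ h]; ring
  have Lmono : ∀ t t', 0 ≤ t → t ≤ t' → t' ≤ T → (L t' - L t).PosSemidef := by
    intro t t' h0 h h1
    have h0' := h0.trans h
    have h1' := h.trans h1
    rcases (αmono t t' h0 h).eq_or_lt with he | hlt
    · have : L t' - L t = (c t' - c t) • (R (α t) - qv (α t)) := by
        rw [hL, hL, ← he, sub_smul]; abel
      rw [this]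
      refine (RP _ (α0 t h0) (α1 t h0)).smul ?_
      simp only [c]
      rw [← he, ← sub_div]
      exact div_nonneg (by linarith) (by linarith [αatt t h0, αR t h0 h1'])
    · have h2 := Lup t h0 h1'
      rw [Rlt _ (hlt.trans_le (α1 t' h0'))] at h2
      exact aux_trans h2 (aux_trans (F1 _ _ (α0 t h0) hlt (α1 t' h0')) (Llow t' h0' h1))
  have Lg : ∀ s : ℝ, 0 ≤ s → s ≤ 1 → L ((qv s).trace) = qv s := by
    intro s h0 h1
    have hg := gnn s h0 h1
    have hs : s ≤ α ((qv s).trace) := (gal _ hg s h0 h1).2 le_rfl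
    have hp := aux_trans (F3 s _ h0 hs (α1 _ hg)) (Llow _ hg (gT s h0 h1))
    have h3 := hp.trace_eq_zero_iff.1 (by rw [trace_sub, Ltr _ hg (gT s h0 h1), sub_self])
    exact sub_eq_zero.1 h3
  have L0 : L 0 = 0 := by
    have := Lg 0 le_rfl zero_le_one
    rwa [g0, hqv0] at this
  have Llip : ∀ t t', 0 ≤ t → t ≤ t' → t' ≤ T →
      Real.sqrt (((L t' - L t) * (L t' - L t)ᵀ).trace) ≤ Real.sqrt D * (t' - t) := by
    intro t t' h0 h h1
    have hb := aux_frob (Lmono t t' h0 h h1)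
    rw [trace_sub, Ltr t' (h0.trans h) h1, Ltr t h0 (h.trans h1)] at hb
    have h5 : Real.sqrt (((L t' - L t) * (L t' - L t)ᵀ).trace) ≤ t' - t :=
      Real.sqrt_le_iff.2 ⟨by linarith, hb⟩
    have h6 : 1 ≤ Real.sqrt D := Real.one_le_sqrt.2 (by exact_mod_cast hD)
    nlinarith
  refine ⟨L, α, fun t ht => ⟨α0 t ht.1, α1 t ht.1⟩, fun t t' ht _ h => αmono t t' ht.1 h,
    ?_, αT, ?_, fun t t' ht ht' h => Lmono t t' ht.1 h ht'.2, L0,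
    fun t ht => Ltr t ht.1 ht.2, ?_, ?_⟩
  · intro t ht
    refine tendsto_order.2 ⟨fun b hb => ?_, fun b hb => ?_⟩
    · filter_upwards [self_mem_nhdsWithin] with u hu
      exact hb.trans_le (αmono t u ht.1 (le_of_lt hu))
    · rcases lt_or_ge 1 b with h | h
      · filter_upwards [self_mem_nhdsWithin] with u hu
        exact (α1 u (ht.1.trans (le_of_lt hu))).trans_lt h
      · have hb0 : 0 ≤ b := (α0 t ht.1).trans hb.le
        have h2 : t < (qv b).trace := by
          by_contra hc
          exact absurd ((gal t ht.1 b hb0 h).2 (not_lt.1 hc)) (not_le.2 hb)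
        filter_upwards [Ioo_mem_nhdsGT h2] with u hu
        by_contra hc
        exact absurd ((gal u (ht.1.trans hu.1.le) b hb0 h).1 (not_lt.1 hc)) (not_le.2 hu.2)
  · intro t ht
    have := Lmono 0 t le_rfl ht.1 ht.2
    rwa [L0, sub_zero] at this
  · intro t ht t' ht'
    rcases le_total t t' with h | h
    · have := Llip t t' ht.1 h ht'.2
      rw [abs_sub_comm, abs_of_nonneg (sub_nonneg.2 h), ← neg_sub (L t') (L t), transpose_neg,
        neg_mul_neg]
      exact this
    · rw [abs_of_nonneg (sub_nonneg.2 h)]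
      exact Llip t' t ht'.1 h ht.2
  · intro s hs
    have : {t : ℝ | t ∈ Icc 0 T ∧ s ≤ α t} = Icc ((qv s).trace) T := by
      ext t
      constructor
      · rintro ⟨h, h'⟩
        exact ⟨(gal t h.1 s hs.1.le hs.2).1 h', h.2⟩
      · rintro ⟨h, h'⟩
        have ht := (gnn s hs.1.le hs.2).trans h
        exact ⟨⟨ht, h'⟩, (gal t ht s hs.1.le hs.2).2 h⟩
    rw [this, csInf_Icc (gT s hs.1.le hs.2), Lg s hs.1.le hs.2]
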